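/- (Case 3, long-interval sub-case) Fix 0 < α < 1 and let c₂ be the Koebe distortion constant and M := 3 an upper bound for |T_β'| on [0,1], uniform in β ∈ (0,α]. For every k ≥ 0 and every interval K intersecting the intermittent region and containing an interval I_{ℓ₋}^k = [a_{ℓ₋+1}^k, a_{ℓ₋}^k] (with ℓ₋ minimal), if the part of K to the right of a_{ℓ₋}^k has length at least |K|/3, then for any sequence β_{k+1}, …, β_{k+ℓ₋+1} ∈ (0, α]: (P_{k+ℓ₋+1} ∘ ⋯ ∘ P_{k+1}) 1_K ≥ (1/(3M²)) |K| e^{−c₂} pointwise on [0,1]. -/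

import Mathlib

open MeasureTheory Set

/-- The Pomeau–Manneville type map `T_β` on `[0,1]` (identified with the circle `S¹`):
`T_β x = x + 3^β/2^(1+β) x^(1+β)` for `x ≤ 2/3` and `T_β x = 3x - 2` otherwise. -/
noncomputable def Tmap (β x : ℝ) : ℝ :=
  if x ≤ 2/3 then x + (3:ℝ)^β / 2^(1+β) * x^(1+β) else 3*x - 2

/-- The derivative of `T_β` (left-branch formula at `x ≤ 2/3`). -/
noncomputable def Tderiv (β x : ℝ) : ℝ :=
  if x ≤ 2/3 then 1 + (3:ℝ)^β / 2^(1+β) * (1+β) * x^β else 3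

/-- The second derivative of `T_β`. -/
noncomputable def Tderiv2 (β x : ℝ) : ℝ :=
  if x ≤ 2/3 then (3:ℝ)^β / 2^(1+β) * (1+β) * β * x^(β-1) else 0

/-- The inverse of the left branch of `T_β` (for `x ∈ [0,1]` this is the unique
`y ∈ [0,2/3]` with `T_β y = x`). -/
noncomputable def leftInv (β x : ℝ) : ℝ :=
  sSup {y : ℝ | y ∈ Set.Icc (0:ℝ) (2/3) ∧ Tmap β y ≤ x}

/-- The Perron–Frobenius transfer operator of `T_β` with respect to Lebesgue measure:
`P_β f (x) = ∑_{y ∈ T_β⁻¹ x} f y / T_β' y`; the right branch preimage of `x` is `(x+2)/3`,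
where the derivative is `3`. -/
noncomputable def Pop (β : ℝ) (f : ℝ → ℝ) (x : ℝ) : ℝ :=
  f (leftInv β x) / Tderiv β (leftInv β x) + f ((x+2)/3) / 3

/-- `P_{β_{k+n}} ∘ ⋯ ∘ P_{β_{k+1}}`. -/
noncomputable def PopCompFrom (β : ℕ → ℝ) (k : ℕ) : ℕ → (ℝ → ℝ) → ℝ → ℝ
  | 0, f => f
  | n+1, f => Pop (β (k+n+1)) (PopCompFrom β k n f)

/-- `P_{β_n} ∘ ⋯ ∘ P_{β_1}`. -/
noncomputable def PopComp (β : ℕ → ℝ) (n : ℕ) : (ℝ → ℝ) → ℝ → ℝ :=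
  PopCompFrom β 0 n

/-- `T_{β_{k+n}} ∘ ⋯ ∘ T_{β_{k+1}}`. -/
noncomputable def TcompFrom (β : ℕ → ℝ) (k : ℕ) : ℕ → ℝ → ℝ
  | 0, x => x
  | n+1, x => Tmap (β (k+n+1)) (TcompFrom β k n x)

/-- The derivative `(T_{β_{k+n}} ∘ ⋯ ∘ T_{β_{k+1}})'(z)`, computed as the product of the
derivatives along the orbit of `z`. -/
noncomputable def DcompFrom (β : ℕ → ℝ) (k n : ℕ) (z : ℝ) : ℝ :=
  ∏ i ∈ Finset.range n, Tderiv (β (k+i+1)) (TcompFrom β k i z)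

/-- The averaging operator `A_ε f (x) = (1/(2ε)) ∫_{B_ε(x)} f dm` on the circle,
realized via the 1-periodic extension of `f`. -/
noncomputable def Aop (ε : ℝ) (f : ℝ → ℝ) (x : ℝ) : ℝ :=
  (1/(2*ε)) * ∫ t in (x-ε)..(x+ε), f (Int.fract t)

/-- The indicator function of the ball `B_ε(z)` of radius `ε` around `z` in the circle `ℝ/ℤ`. -/
noncomputable def ballInd (ε z : ℝ) : ℝ → ℝ :=
  Set.indicator {y : ℝ | ∃ k : ℤ, |y - z - (k:ℝ)| < ε} (fun _ => 1)

/-- The cone `C₁ = {f ∈ C⁰((0,1]) : f ≥ 0, f decreasing, x ↦ x^(α+1) f x increasing}`. -/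
def memC1 (α : ℝ) (f : ℝ → ℝ) : Prop :=
  ContinuousOn f (Set.Ioc 0 1) ∧ (∀ x ∈ Set.Ioc (0:ℝ) 1, 0 ≤ f x) ∧
  AntitoneOn f (Set.Ioc 0 1) ∧ MonotoneOn (fun x : ℝ => x^(α+1) * f x) (Set.Ioc 0 1)

/-- `m(f) = ∫₀¹ f dm` (Lebesgue). -/
noncomputable def mInt (f : ℝ → ℝ) : ℝ := ∫ x in Set.Ioc (0:ℝ) 1, f x

/-- The cone `C₂ = {f ∈ C₁ ∩ L¹(m) : f x ≤ a x^(-α) m(f)}`. -/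
def memC2 (α a : ℝ) (f : ℝ → ℝ) : Prop :=
  memC1 α f ∧ IntegrableOn f (Set.Ioc 0 1) volume ∧
  ∀ x ∈ Set.Ioc (0:ℝ) 1, f x ≤ a * x^(-α) * mInt f

/-- The `L¹(m)` norm on `[0,1]`. -/
noncomputable def L1norm (f : ℝ → ℝ) : ℝ := ∫ x in Set.Ioc (0:ℝ) 1, |f x|

/-- The `C¹` norm `‖f‖_∞ + ‖f'‖_∞` on the circle. -/
noncomputable def C1norm (f : ℝ → ℝ) : ℝ :=
  (⨆ x : Set.Icc (0:ℝ) 1, |f (x:ℝ)|) + ⨆ x : Set.Icc (0:ℝ) 1, |deriv f (x:ℝ)|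

theorem rpow_tangent_le {β a b : ℝ} (hβ : 0 < β) (ha : 0 ≤ a) (hab : a ≤ b) :
    (1 + β) * a ^ β * (b - a) ≤ b ^ (1 + β) - a ^ (1 + β) := by
  rcases ha.eq_or_lt with rfl | ha
  · rw [Real.zero_rpow hβ.ne', Real.zero_rpow (by linarith)]
    have := Real.rpow_nonneg hab (1 + β)
    linarith
  · have hs : -1 ≤ (b - a) / a := by
      have : 0 ≤ (b - a) / a := div_nonneg (by linarith) ha.le
      linarith
    have bern := one_add_mul_self_le_rpow_one_add hs (p := 1 + β) (by linarith)
    have hb : b = a * (1 + (b - a) / a) := by field_simp; ring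
    have hpow : b ^ (1 + β) = a ^ (1 + β) * (1 + (b - a) / a) ^ (1 + β) := by
      conv_lhs => rw [hb]
      exact Real.mul_rpow ha.le (by linarith)
    have hmul := mul_le_mul_of_nonneg_left bern (Real.rpow_nonneg ha.le (1 + β))
    have hsplit : a ^ (1 + β) = a * a ^ β := by rw [Real.rpow_add ha, Real.rpow_one]
    rw [← hpow] at hmul
    have hexp : a ^ (1 + β) * (1 + (1 + β) * ((b - a) / a))
        = a ^ (1 + β) + (1 + β) * a ^ β * (b - a) := by
      rw [hsplit]; field_simp
    linarith

theorem one_le_Tderiv {β y : ℝ} (hβ : 0 < β) (hy : 0 ≤ y) : 1 ≤ Tderiv β y := by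
  unfold Tderiv
  split_ifs
  · have : 0 ≤ (3:ℝ) ^ β / 2 ^ (1 + β) * (1 + β) * y ^ β := by positivity
    linarith
  · norm_num

theorem coeff_mul_rpow (β : ℝ) : (3:ℝ) ^ β / 2 ^ (1 + β) * (2 / 3) ^ β = 1 / 2 := by
  rw [Real.div_rpow (by norm_num) (by norm_num), Real.rpow_add (by norm_num), Real.rpow_one]
  have h2 : (2:ℝ) ^ β ≠ 0 := (Real.rpow_pos_of_pos (by norm_num) β).ne'
  have h3 : (3:ℝ) ^ β ≠ 0 := (Real.rpow_pos_of_pos (by norm_num) β).ne'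
  field_simp

theorem Tderiv_le_three {β y : ℝ} (hβ : 0 < β) (hβ1 : β < 1) (hy : 0 ≤ y) :
    Tderiv β y ≤ 3 := by
  unfold Tderiv
  split_ifs with h
  · have hp : y ^ β ≤ (2 / 3) ^ β := Real.rpow_le_rpow hy h hβ.le
    have hc : 0 ≤ (3:ℝ) ^ β / 2 ^ (1 + β) := by positivity
    have hm := mul_le_mul_of_nonneg_left hp hc
    rw [coeff_mul_rpow] at hm
    nlinarith
  · exact le_rfl

theorem Tmap_two_thirds (β : ℝ) : Tmap β (2 / 3) = 1 := by
  unfold Tmap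
  rw [if_pos le_rfl, Real.rpow_add (by norm_num : (0:ℝ) < 2 / 3), Real.rpow_one]
  linear_combination (2 / 3) * coeff_mul_rpow β

theorem Tmap_zero {β : ℝ} (hβ : 0 < β) : Tmap β 0 = 0 := by
  unfold Tmap
  rw [if_pos (by norm_num), Real.zero_rpow (by linarith)]
  simp

/-- The left branch is convex: its slope at `y` is at most its slope on any interval to the
right of `y`. -/
theorem Tderiv_mul_sub_le {β y a b : ℝ} (hβ : 0 < β) (hy : 0 ≤ y) (hya : y ≤ a) (hab : a ≤ b)
    (hb : b ≤ 2 / 3) : Tderiv β y * (b - a) ≤ Tmap β b - Tmap β a := by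
  unfold Tderiv Tmap
  rw [if_pos (by linarith), if_pos hb, if_pos (by linarith)]
  have hp : y ^ β ≤ a ^ β := Real.rpow_le_rpow hy hya hβ.le
  have ht := rpow_tangent_le hβ (hy.trans hya) hab
  have hle : (1 + β) * y ^ β * (b - a) ≤ b ^ (1 + β) - a ^ (1 + β) := by
    refine le_trans ?_ ht
    gcongr
  have hc : 0 ≤ (3:ℝ) ^ β / 2 ^ (1 + β) := by positivity
  have hm := mul_le_mul_of_nonneg_left hle hc
  linarith

theorem Tmap_le_iff {β a b : ℝ} (hβ : 0 < β) (ha : a ∈ Icc (0:ℝ) (2 / 3))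
    (hb : b ∈ Icc (0:ℝ) (2 / 3)) : Tmap β a ≤ Tmap β b ↔ a ≤ b := by
  have key : ∀ {a b : ℝ}, 0 ≤ a → a ≤ b → b ≤ 2 / 3 → b - a ≤ Tmap β b - Tmap β a := by
    intro a b h0 hab hb
    have h1 := Tderiv_mul_sub_le hβ h0 le_rfl hab hb
    have h2 := one_le_Tderiv hβ h0
    nlinarith
  constructor
  · intro h
    by_contra! hlt
    linarith [key hb.1 hlt.le ha.2]
  · intro h
    linarith [key ha.1 h hb.2]

theorem continuousOn_Tmap {β : ℝ} (hβ : 0 < β) : ContinuousOn (Tmap β) (Icc 0 (2 / 3)) := by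
  have hc : Continuous fun x : ℝ => x + (3:ℝ) ^ β / 2 ^ (1 + β) * x ^ (1 + β) :=
    continuous_id.add (continuous_const.mul (Real.continuous_rpow_const (by linarith)))
  refine hc.continuousOn.congr fun x hx => ?_
  simp only [Tmap, if_pos hx.2]

theorem leftInv_Tmap {β w : ℝ} (hβ : 0 < β) (hw : w ∈ Icc (0:ℝ) (2 / 3)) :
    leftInv β (Tmap β w) = w := by
  have hset : {y : ℝ | y ∈ Icc (0:ℝ) (2 / 3) ∧ Tmap β y ≤ Tmap β w} = Icc 0 w := by
    ext y
    constructor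
    · rintro ⟨hy, h⟩
      exact ⟨hy.1, (Tmap_le_iff hβ hy hw).1 h⟩
    · rintro ⟨h0, h⟩
      have hy : y ∈ Icc (0:ℝ) (2 / 3) := ⟨h0, h.trans hw.2⟩
      exact ⟨hy, (Tmap_le_iff hβ hy hw).2 h⟩
  rw [leftInv, hset, csSup_Icc hw.1]

theorem leftInv_nonneg (β x : ℝ) : 0 ≤ leftInv β x :=
  Real.sSup_nonneg fun _ hy => hy.1.1

theorem leftInv_spec {β x : ℝ} (hβ : 0 < β) (hx : x ∈ Icc (0:ℝ) 1) :
    leftInv β x ∈ Icc (0:ℝ) (2 / 3) ∧ Tmap β (leftInv β x) = x := by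
  have hivt := intermediate_value_Icc (by norm_num) (continuousOn_Tmap hβ)
  rw [Tmap_zero hβ, Tmap_two_thirds] at hivt
  obtain ⟨w, hw, rfl⟩ := hivt hx
  rw [leftInv_Tmap hβ hw]
  exact ⟨hw, rfl⟩

theorem Pop_nonneg {β : ℝ} (hβ : 0 < β) {f : ℝ → ℝ} (hf : ∀ x, 0 ≤ f x) (x : ℝ) :
    0 ≤ Pop β f x := by
  have h := one_le_Tderiv hβ (leftInv_nonneg β x)
  exact add_nonneg (div_nonneg (hf _) (by linarith)) (div_nonneg (hf _) (by norm_num))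

theorem PopCompFrom_nonneg {β : ℕ → ℝ} (hβ : ∀ i, 0 < β i) (k : ℕ) {f : ℝ → ℝ}
    (hf : ∀ x, 0 ≤ f x) (n : ℕ) (x : ℝ) : 0 ≤ PopCompFrom β k n f x := by
  induction n generalizing x with
  | zero => exact hf x
  | succ n ih => exact Pop_nonneg (hβ _) ih x

theorem le_Tderiv_mul_Pop {β : ℝ} (hβ : 0 < β) {f : ℝ → ℝ} (hf : ∀ x, 0 ≤ f x) (x : ℝ) :
    f (leftInv β x) ≤ Tderiv β (leftInv β x) * Pop β f x := by
  have h := one_le_Tderiv hβ (leftInv_nonneg β x)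
  rw [← div_le_iff₀' (by linarith)]
  exact le_add_of_nonneg_right (div_nonneg (hf _) (by norm_num))

section Preimages

variable {β : ℕ → ℝ} {A : ℕ → ℕ → ℝ}

theorem preimage_one_eq (hβ : ∀ i, 0 < β i) (hA0 : ∀ k, A k 0 = 1)
    (hA : ∀ k n : ℕ, A k (n+1) ∈ Icc (0:ℝ) (2/3) ∧ Tmap (β (k+1)) (A k (n+1)) = A (k+1) n)
    (k : ℕ) : A k 1 = 2 / 3 := by
  obtain ⟨hmem, hT⟩ := hA k 0
  refine le_antisymm hmem.2 ((Tmap_le_iff (hβ (k + 1)) ⟨by norm_num, le_rfl⟩ hmem).1 ?_)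
  rw [hT, Tmap_two_thirds, hA0]

theorem preimage_succ_le (hβ : ∀ i, 0 < β i) (hA0 : ∀ k, A k 0 = 1)
    (hA : ∀ k n : ℕ, A k (n+1) ∈ Icc (0:ℝ) (2/3) ∧ Tmap (β (k+1)) (A k (n+1)) = A (k+1) n)
    (n k : ℕ) : A k (n + 1) ≤ A k n := by
  induction n generalizing k with
  | zero =>
    rw [hA0]
    linarith [(hA k 0).1.2]
  | succ n ih =>
    refine (Tmap_le_iff (hβ (k + 1)) (hA k (n + 1)).1 (hA k n).1).1 ?_
    rw [(hA k (n + 1)).2, (hA k n).2]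
    exact ih (k + 1)

theorem preimage_mem_Icc (hA0 : ∀ k, A k 0 = 1)
    (hA : ∀ k n : ℕ, A k (n+1) ∈ Icc (0:ℝ) (2/3) ∧ Tmap (β (k+1)) (A k (n+1)) = A (k+1) n)
    (n k : ℕ) : A k n ∈ Icc (0:ℝ) 1 := by
  cases n with
  | zero => simp [hA0]
  | succ n => exact ⟨(hA k n).1.1, (hA k n).1.2.trans (by norm_num)⟩

theorem leftInv_mem_preimage_Icc (hβ : ∀ i, 0 < β i) (hA0 : ∀ k, A k 0 = 1)
    (hA : ∀ k n : ℕ, A k (n+1) ∈ Icc (0:ℝ) (2/3) ∧ Tmap (β (k+1)) (A k (n+1)) = A (k+1) n)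
    {k m : ℕ} {x : ℝ} (hx : x ∈ Icc (A (k+1) (m+1)) (A (k+1) m)) :
    leftInv (β (k+1)) x ∈ Icc (A k (m+2)) (A k (m+1)) := by
  have hx01 : x ∈ Icc (0:ℝ) 1 :=
    ⟨(preimage_mem_Icc hA0 hA (m + 1) (k + 1)).1.trans hx.1,
      hx.2.trans (preimage_mem_Icc hA0 hA m (k + 1)).2⟩
  obtain ⟨hmem, hT⟩ := leftInv_spec (hβ (k + 1)) hx01
  constructor
  · rw [← Tmap_le_iff (hβ (k + 1)) (hA k (m + 1)).1 hmem, hT, (hA k (m + 1)).2]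
    exact hx.1
  · rw [← Tmap_le_iff (hβ (k + 1)) hmem (hA k m).1, hT, (hA k m).2]
    exact hx.2

/-- Along the left branches the composed transfer operator at `x` is bounded below by
`f y / D`, where `y` is the preimage of `x` and `D` is at most the mean slope of the composed
map on the partition interval adjacent on the right to the one containing `y`. -/
theorem exists_preimage_le_mul_PopCompFrom (hβ : ∀ i, 0 < β i) (hA0 : ∀ k, A k 0 = 1)
    (hA : ∀ k n : ℕ, A k (n+1) ∈ Icc (0:ℝ) (2/3) ∧ Tmap (β (k+1)) (A k (n+1)) = A (k+1) n)
    (k : ℕ) {f : ℝ → ℝ} (hf : ∀ x, 0 ≤ f x) (n m : ℕ) {x : ℝ}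
    (hx : x ∈ Icc (A (k+n) (m+2)) (A (k+n) (m+1))) :
    ∃ y ∈ Icc (A k (n+m+2)) (A k (n+m+1)), ∃ D > 0, f y ≤ D * PopCompFrom β k n f x ∧
      D * (A k (n+m) - A k (n+m+1)) ≤ A (k+n) m - A (k+n) (m+1) := by
  induction n generalizing m x with
  | zero =>
    refine ⟨x, by simpa using hx, 1, one_pos, ?_, ?_⟩
    · simp [PopCompFrom]
    · simp
  | succ n ih =>
    have hw := leftInv_mem_preimage_Icc hβ hA0 hA (k := k + n) (m := m + 1) hx
    set w := leftInv (β (k + n + 1)) x with hwdef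
    obtain ⟨y, hy, D, hD, hfy, hlen⟩ := ih (m + 1) hw
    have hidx : n + 1 + m = n + (m + 1) := by ring
    rw [hidx]
    have hw0 : 0 ≤ w := leftInv_nonneg _ _
    have hT1 := one_le_Tderiv (hβ (k + n + 1)) hw0
    refine ⟨y, hy, D * Tderiv (β (k + n + 1)) w, by positivity, ?_, ?_⟩
    · have h := le_Tderiv_mul_Pop (hβ (k + n + 1)) (PopCompFrom_nonneg hβ k hf n) x
      calc f y ≤ D * PopCompFrom β k n f w := hfy
        _ ≤ D * (Tderiv (β (k + n + 1)) w * PopCompFrom β k (n + 1) f x) :=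
            mul_le_mul_of_nonneg_left h hD.le
        _ = _ := by ring
    · have hslope := Tderiv_mul_sub_le (hβ (k + n + 1)) hw0 hw.2
        (preimage_succ_le hβ hA0 hA (m + 1) (k + n)) (hA (k + n) m).1.2
      rw [(hA (k + n) m).2, (hA (k + n) (m + 1)).2] at hslope
      calc D * Tderiv (β (k + n + 1)) w * (A k (n + (m + 1)) - A k (n + (m + 1) + 1))
          = Tderiv (β (k + n + 1)) w * (D * (A k (n + (m + 1)) - A k (n + (m + 1) + 1))) := by
            ring
        _ ≤ Tderiv (β (k + n + 1)) w * (A (k + n) (m + 1) - A (k + n) (m + 1 + 1)) :=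
            mul_le_mul_of_nonneg_left hlen (by linarith)
        _ ≤ _ := hslope

end Preimages

/-- Case 3, long-interval sub-case: with `M = 3` a uniform bound for
`|T_β'|` and `c₂` the Koebe distortion constant, for every interval `K = [u,v]`
intersecting the intermittent region `I = [0,4/9]` and containing `I_{ℓ₋}^k` with `ℓ₋`
minimal, if the part of `K` to the right of `a_{ℓ₋}^k` has length at least `|K|/3`, then
`(P_{k+ℓ₋+1} ∘ ⋯ ∘ P_{k+1}) 1_K ≥ (1/(3M²)) |K| e^{-c₂}` pointwise on `[0,1]`. -/
theorem case3_long_right_part (α : ℝ) (hα0 : 0 < α) (hα1 : α < 1) :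
    ∃ c₂ > 0, ∀ β : ℕ → ℝ, (∀ i, β i ∈ Set.Ioc (0:ℝ) α) →
      ∀ A : ℕ → ℕ → ℝ, (∀ k, A k 0 = 1) →
      (∀ k n : ℕ, A k (n+1) ∈ Set.Icc (0:ℝ) (2/3) ∧ Tmap (β (k+1)) (A k (n+1)) = A (k+1) n) →
      ∀ k lminus : ℕ, ∀ u v : ℝ, u ≤ v → Set.Icc u v ⊆ Set.Icc (0:ℝ) 1 →
      (Set.Icc u v ∩ Set.Icc (0:ℝ) (4/9)).Nonempty →
      Set.Icc (A k (lminus+1)) (A k lminus) ⊆ Set.Icc u v →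
      (∀ ℓ, ℓ < lminus → ¬ Set.Icc (A k (ℓ+1)) (A k ℓ) ⊆ Set.Icc u v) →
      (v - u)/3 ≤ v - A k lminus →
      ∀ x ∈ Set.Icc (0:ℝ) 1,
        (1/(3*3^2)) * (v - u) * Real.exp (-c₂) ≤
          PopCompFrom β k (lminus+1) (Set.indicator (Set.Icc u v) fun _ => 1) x := by
  refine ⟨1, one_pos, fun β hβ A hA0 hA k l u v huv hsubK _ hsub hmin hlen x hx => ?_⟩
  have hβ0 : ∀ i, 0 < β i := fun i => (hβ i).1
  set f : ℝ → ℝ := Set.indicator (Set.Icc u v) fun _ => 1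
  have hf : ∀ x, 0 ≤ f x := Set.indicator_nonneg fun _ _ => zero_le_one
  have hanti := preimage_succ_le hβ0 hA0 hA
  have hr := hsub (right_mem_Icc.2 (hanti l k))
  have hexp : Real.exp (-1) ≤ 1 := Real.exp_le_one_iff.2 (by norm_num)
  have hlhs : (1/(3*3^2)) * (v - u) * Real.exp (-1) ≤ (v - u) / 27 := by
    have := mul_le_mul_of_nonneg_left hexp (sub_nonneg.2 huv)
    linarith
  refine hlhs.trans ?_
  have hpos := PopCompFrom_nonneg hβ0 k hf
  cases l with
  | zero =>
    have hsub01 := hsubK (right_mem_Icc.2 huv)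
    rw [hA0] at hlen
    linarith [hpos 1 x, hsub01.2]
  | succ n =>
    have hv : v < A k n := by
      by_contra! h
      exact hmin n n.lt_succ_self (Icc_subset_Icc hr.1 h)
    have hz : (x + 2) / 3 ∈ Icc (A (k + n + 1) 1) (A (k + n + 1) 0) := by
      rw [preimage_one_eq hβ0 hA0 hA, hA0]
      constructor <;> linarith [hx.1, hx.2]
    have hw := leftInv_mem_preimage_Icc hβ0 hA0 hA hz
    set w := leftInv (β (k + n + 1)) ((x + 2) / 3)
    have hw0 : 0 ≤ w := leftInv_nonneg _ _
    obtain ⟨y, hy, D, hD, hfy, hDlen⟩ :=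
      exists_preimage_le_mul_PopCompFrom hβ0 hA0 hA k hf n 0 hw
    rw [show f y = 1 from Set.indicator_of_mem (hsub hy) _] at hfy
    simp only [add_zero, zero_add, hA0, preimage_one_eq hβ0 hA0 hA] at hDlen
    have hleft := le_Tderiv_mul_Pop (hβ0 (k + n + 1)) (hpos n) ((x + 2) / 3)
    have hright : PopCompFrom β k (n + 1) f ((x + 2) / 3) / 3 ≤ PopCompFrom β k (n + 1 + 1) f x :=
      le_add_of_nonneg_left (div_nonneg (hpos (n + 1) _)
        (zero_le_one.trans (one_le_Tderiv (hβ0 _) (leftInv_nonneg _ _))))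
    have hthree : PopCompFrom β k n f w ≤ 3 * PopCompFrom β k (n + 1) f ((x + 2) / 3) :=
      hleft.trans (mul_le_mul_of_nonneg_right
        (Tderiv_le_three (hβ0 _) ((hβ _).2.trans_lt hα1) hw0) (hpos (n + 1) _))
    have hK : D * (v - u) ≤ 1 := by nlinarith
    have hPn : v - u ≤ PopCompFrom β k n f w :=
      le_of_mul_le_mul_left (hK.trans hfy) hD
    linarith
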